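/- arXiv:2404.15167 — 3 statements merged into one kernel-verified Lean document; each statement's English description precedes it below -/
import Mathlib

section
/- Let G be a finite simple graph on n vertices with n ≥ 2, and let Ḡ be its complement. Then max{Gap(G), Gap(Ḡ)} ≥ ((3 − √5)/8) · (1/(n − 1)). -/
open Classical in
/-- Transition matrix of the simple random walk on `G`:
`P v w = 1/deg(v)` if `v ~ w`, else `0`. -/
noncomputable def transitionMatrix {V : Type*} [Fintype V] (G : SimpleGraph V) :
    Matrix V V ℝ :=
  fun v w => if G.Adj v w then ((G.degree v : ℝ))⁻¹ else 0

/-- The second-largest eigenvalue of a matrix with real spectrum: the second-largest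
root (with multiplicity) of its characteristic polynomial. -/
noncomputable def lambda2 {V : Type*} [Fintype V] [DecidableEq V] (M : Matrix V V ℝ) : ℝ :=
  (M.charpoly.roots.sort (· ≤ ·)).getD ((M.charpoly.roots.sort (· ≤ ·)).length - 2) 0

open Classical in
/-- Spectral gap of the random walk on `G`; by convention `0` if some vertex is isolated. -/
noncomputable def spectralGap {V : Type*} [Fintype V] (G : SimpleGraph V) : ℝ :=
  if ∀ v, 0 < G.degree v then 1 - lambda2 (transitionMatrix G) else 0

open Matrix in
/-- If the second-largest eigenvalue of a symmetric matrix `N` is at least `t`, then every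
hyperplane contains a nonzero vector whose Rayleigh quotient is at least `t`. -/
theorem exists_rayleigh_ge_of_le_lambda2 {V : Type*} [Fintype V] [DecidableEq V]
    {N : Matrix V V ℝ} (hN : N.IsHermitian) (hn : 2 ≤ Fintype.card V) {t : ℝ}
    (ht : t ≤ lambda2 N) (s : V → ℝ) :
    ∃ h : V → ℝ, 0 < h ⬝ᵥ h ∧ s ⬝ᵥ h = 0 ∧ t * (h ⬝ᵥ h) ≤ h ⬝ᵥ (N *ᵥ h) := by
  have hroots := hN.roots_charpoly_eq_eigenvalues
  have hcount : 2 ≤ (N.charpoly.roots.filter (t ≤ ·)).card := by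
    unfold lambda2 at ht
    have hsorted := N.charpoly.roots.pairwise_sort (· ≤ ·)
    have hperm := N.charpoly.roots.sort_eq (· ≤ ·)
    have hlen : (N.charpoly.roots.sort (· ≤ ·)).length = Fintype.card V := by
      rw [Multiset.length_sort, hroots]
      simp
    generalize N.charpoly.roots.sort (· ≤ ·) = L at *
    rw [← hperm, Multiset.filter_coe, Multiset.coe_card]
    have hlt : L.length - 2 < L.length := by omega
    rw [List.getD_eq_getElem _ _ hlt] at ht
    have hdrop : (L.drop (L.length - 2)).filter (t ≤ ·) = L.drop (L.length - 2) := by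
      rw [List.filter_eq_self]
      intro a ha
      obtain ⟨k, hk, rfl⟩ := List.mem_iff_getElem.1 ha
      rw [List.getElem_drop]
      have := hsorted.rel_get_of_le (a := ⟨L.length - 2, hlt⟩)
        (b := ⟨L.length - 2 + k, by simp at hk; omega⟩) (by simp)
      simpa using ht.trans this
    calc 2 = (L.drop (L.length - 2)).length := by rw [List.length_drop]; omega
      _ = ((L.drop (L.length - 2)).filter (t ≤ ·)).length := by rw [hdrop]
      _ ≤ _ := ((List.drop_sublist _ L).filter _).length_le
  have hcard : 1 < (Finset.univ.filter fun i => t ≤ hN.eigenvalues i).card := by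
    rw [hroots, Multiset.filter_map, Multiset.card_map] at hcount
    exact hcount
  obtain ⟨i, hi, j, hj, hij⟩ := Finset.one_lt_card.1 hcard
  simp only [Finset.mem_filter, Finset.mem_univ, true_and] at hi hj
  have horth : ∀ a b, (hN.eigenvectorBasis a : V → ℝ) ⬝ᵥ (hN.eigenvectorBasis b : V → ℝ) =
      if a = b then 1 else 0 := by
    intro a b
    have := orthonormal_iff_ite.1 hN.eigenvectorBasis.orthonormal b a
    rw [EuclideanSpace.inner_eq_star_dotProduct] at this
    simpa [eq_comm] using this
  have hui := hN.mulVec_eigenvectorBasis i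
  have huj := hN.mulVec_eigenvectorBasis j
  have hii := horth i i
  have hjj := horth j j
  have hij0 := horth i j
  have hji := horth j i
  simp only [if_true, hij, hij.symm, if_false] at hii hjj hij0 hji
  generalize (hN.eigenvectorBasis i : V → ℝ) = u at *
  generalize (hN.eigenvectorBasis j : V → ℝ) = w at *
  obtain ⟨α, β, hpos, hzero⟩ : ∃ α β : ℝ, 0 < α ^ 2 + β ^ 2 ∧
      α * (s ⬝ᵥ u) + β * (s ⬝ᵥ w) = 0 := by
    by_cases h : s ⬝ᵥ u = 0
    · exact ⟨1, 0, by norm_num, by simp [h]⟩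
    · exact ⟨s ⬝ᵥ w, -(s ⬝ᵥ u),
        add_pos_of_nonneg_of_pos (sq_nonneg _) (sq_pos_of_ne_zero (neg_ne_zero.2 h)), by ring⟩
  have hself : (α • u + β • w) ⬝ᵥ (α • u + β • w) = α ^ 2 + β ^ 2 := by
    simp only [add_dotProduct, dotProduct_add, smul_dotProduct, dotProduct_smul, smul_eq_mul,
      hii, hjj, hij0, hji]
    ring
  refine ⟨α • u + β • w, hself ▸ hpos, ?_, ?_⟩
  · simpa [dotProduct_add, dotProduct_smul] using hzero
  · rw [hself]
    simp only [mulVec_add, mulVec_smul, hui, huj, add_dotProduct, dotProduct_add, smul_dotProduct,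
      dotProduct_smul, smul_eq_mul, hii, hjj, hij0, hji]
    nlinarith [mul_le_mul_of_nonneg_left hi (sq_nonneg α),
      mul_le_mul_of_nonneg_left hj (sq_nonneg β)]

open Classical in
/-- The Dirichlet form of a graph, summed over ordered pairs of adjacent vertices. -/
noncomputable def dirichletForm {V : Type*} [Fintype V] (G : SimpleGraph V) (f : V → ℝ) : ℝ :=
  ∑ v, ∑ w, if G.Adj v w then (f v - f w) ^ 2 else 0

open Classical in
theorem dirichletForm_eq {V : Type*} [Fintype V] (G : SimpleGraph V) (f : V → ℝ) :
    dirichletForm G f = 2 * ∑ v, (G.degree v : ℝ) * f v ^ 2 -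
      2 * ∑ v, ∑ w, if G.Adj v w then f v * f w else 0 := by
  have hdeg : ∀ v, (G.degree v : ℝ) * f v ^ 2 = ∑ w, if G.Adj v w then f v ^ 2 else 0 := by
    intro v
    rw [← Finset.sum_filter, Finset.sum_const, nsmul_eq_mul, ← G.card_neighborFinset_eq_degree,
      G.neighborFinset_eq_filter]
  have hsymm : (∑ v, ∑ w, if G.Adj v w then f v ^ 2 else 0) =
      ∑ v, ∑ w, if G.Adj v w then f w ^ 2 else 0 := by
    rw [Finset.sum_comm]
    simp only [G.adj_comm]
  simp only [hdeg]
  rw [two_mul (∑ v, ∑ w, if G.Adj v w then f v ^ 2 else 0)]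
  nth_rewrite 2 [hsymm]
  simp only [dirichletForm, Finset.mul_sum, ← Finset.sum_add_distrib, ← Finset.sum_sub_distrib]
  refine Finset.sum_congr rfl fun v _ => Finset.sum_congr rfl fun w _ => ?_
  split_ifs <;> ring

open Classical in
/-- The symmetric normalisation `D^(-1/2) A D^(-1/2)` of the transition matrix. -/
noncomputable def normalizedAdjMatrix {V : Type*} [Fintype V] (G : SimpleGraph V) :
    Matrix V V ℝ :=
  fun v w => if G.Adj v w then (√(G.degree v : ℝ))⁻¹ * (√(G.degree w : ℝ))⁻¹ else 0

theorem normalizedAdjMatrix_isHermitian {V : Type*} [Fintype V] (G : SimpleGraph V) :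
    (normalizedAdjMatrix G).IsHermitian := by
  ext v w
  by_cases h : G.Adj v w
  · simp [normalizedAdjMatrix, h, h.symm, mul_comm]
  · have h_symm : ¬ G.Adj w v := fun hwv => h hwv.symm
    simp [normalizedAdjMatrix, h, h_symm]

open Classical in
theorem charpoly_transitionMatrix {V : Type*} [Fintype V] (G : SimpleGraph V)
    (hG : ∀ v, 0 < G.degree v) :
    (transitionMatrix G).charpoly = (normalizedAdjMatrix G).charpoly := by
  have hs : ∀ v, √(G.degree v : ℝ) ≠ 0 := fun v =>
    (Real.sqrt_pos.2 (Nat.cast_pos.2 (hG v))).ne'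
  have hP : transitionMatrix G = Matrix.diagonal (fun v => (√(G.degree v : ℝ))⁻¹) *
      (normalizedAdjMatrix G * Matrix.diagonal fun v => √(G.degree v : ℝ)) := by
    ext v w
    rw [Matrix.diagonal_mul, Matrix.mul_diagonal, transitionMatrix, normalizedAdjMatrix]
    split_ifs
    · rw [mul_assoc, inv_mul_cancel₀ (hs w), mul_one, ← mul_inv,
        Real.mul_self_sqrt (Nat.cast_nonneg _)]
    · simp
  have hD : Matrix.diagonal (fun v => √(G.degree v : ℝ)) *
      Matrix.diagonal (fun v => (√(G.degree v : ℝ))⁻¹) = 1 := by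
    simp [Matrix.diagonal_mul_diagonal, mul_inv_cancel₀ (hs _)]
  rw [hP, Matrix.charpoly_mul_comm, Matrix.mul_assoc, hD, Matrix.mul_one]

open Classical in
/-- A small spectral gap yields a nonzero mean-zero function with small Dirichlet form. -/
theorem exists_dirichletForm_le {V : Type*} [Fintype V] (G : SimpleGraph V)
    (hn : 2 ≤ Fintype.card V) {c : ℝ} (hc : 0 ≤ c)
    (hgap : spectralGap G < c * (1 / ((Fintype.card V : ℝ) - 1))) :
    ∃ f : V → ℝ, 0 < ∑ v, f v ^ 2 ∧ ∑ v, f v = 0 ∧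
      dirichletForm G f ≤ 2 * c * ∑ v, f v ^ 2 := by
  have hn' : (0 : ℝ) < (Fintype.card V : ℝ) - 1 := by
    have : (2 : ℝ) ≤ Fintype.card V := by exact_mod_cast hn
    linarith
  by_cases hG : ∀ v, 0 < G.degree v
  · rw [spectralGap, if_pos hG] at hgap
    have ht : 1 - c * (1 / ((Fintype.card V : ℝ) - 1)) ≤ lambda2 (normalizedAdjMatrix G) := by
      have : lambda2 (normalizedAdjMatrix G) = lambda2 (transitionMatrix G) := by
        simp only [lambda2, charpoly_transitionMatrix G hG]
      linarith
    have hs : ∀ v, 0 < √(G.degree v : ℝ) := fun v => Real.sqrt_pos.2 (Nat.cast_pos.2 (hG v))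
    obtain ⟨h, hpos, hsum, hray⟩ := exists_rayleigh_ge_of_le_lambda2
      (normalizedAdjMatrix_isHermitian G) hn ht fun v => (√(G.degree v : ℝ))⁻¹
    set f : V → ℝ := fun v => (√(G.degree v : ℝ))⁻¹ * h v with hf
    have hhh : h ⬝ᵥ h = ∑ v, (G.degree v : ℝ) * f v ^ 2 := by
      refine Finset.sum_congr rfl fun v _ => ?_
      simp only [hf, mul_pow, inv_pow, Real.sq_sqrt (Nat.cast_nonneg (α := ℝ) (G.degree v))]
      have : (G.degree v : ℝ) ≠ 0 := (Nat.cast_pos.2 (hG v)).ne'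
      field_simp
    have hNh : h ⬝ᵥ (normalizedAdjMatrix G).mulVec h =
        ∑ v, ∑ w, if G.Adj v w then f v * f w else 0 := by
      simp only [dotProduct, Matrix.mulVec, Finset.mul_sum]
      refine Finset.sum_congr rfl fun v _ => Finset.sum_congr rfl fun w _ => ?_
      simp only [normalizedAdjMatrix, hf]
      split_ifs <;> ring
    have hle : h ⬝ᵥ h ≤ ((Fintype.card V : ℝ) - 1) * ∑ v, f v ^ 2 := by
      rw [hhh, Finset.mul_sum]
      refine Finset.sum_le_sum fun v _ => mul_le_mul_of_nonneg_right ?_ (sq_nonneg _)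
      have : G.degree v + 1 ≤ Fintype.card V := G.degree_lt_card_verts v
      have : (G.degree v : ℝ) + 1 ≤ Fintype.card V := by exact_mod_cast this
      linarith
    refine ⟨f, ?_, hsum, ?_⟩
    · exact (pos_iff_pos_of_mul_pos (hpos.trans_le hle)).1 hn'
    · rw [dirichletForm_eq, ← hhh, ← hNh]
      have : c * (1 / ((Fintype.card V : ℝ) - 1)) * (h ⬝ᵥ h) ≤ c * ∑ v, f v ^ 2 := by
        rw [mul_assoc]
        refine mul_le_mul_of_nonneg_left ?_ hc
        rw [one_div, inv_mul_le_iff₀ hn']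
        exact hle
      linarith
  · push Not at hG
    obtain ⟨v, hv⟩ := hG
    have hv0 : ∀ w, ¬ G.Adj v w := fun w hw =>
      absurd ((G.degree_pos_iff_exists_adj v).2 ⟨w, hw⟩) (by omega)
    have hcard : (Fintype.card V : ℝ) ≠ 0 := by
      have : 0 < Fintype.card V := by omega
      positivity
    obtain ⟨f, hf⟩ : ∃ f : V → ℝ,
        f = fun w => (if w = v then 1 else 0) - 1 / (Fintype.card V : ℝ) := ⟨_, rfl⟩
    have hform : dirichletForm G f = 0 := by
      refine Finset.sum_eq_zero fun a _ => Finset.sum_eq_zero fun b _ => ?_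
      split_ifs with hab
      · have ha : a ≠ v := by rintro rfl; exact hv0 b hab
        have hb : b ≠ v := by rintro rfl; exact hv0 a hab.symm
        simp [hf, ha, hb]
      · rfl
    have hpos : 0 < ∑ w, f w ^ 2 := by
      refine Finset.sum_pos' (fun _ _ => sq_nonneg _) ⟨v, Finset.mem_univ v, ?_⟩
      have : 1 / (Fintype.card V : ℝ) < 1 := by
        rw [div_lt_one] <;> linarith
      simp only [hf, if_true]
      exact pow_pos (by linarith) 2
    refine ⟨f, hpos, ?_, ?_⟩
    · simp only [hf, Finset.sum_sub_distrib, Finset.sum_ite_eq', Finset.mem_univ, if_true,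
        Finset.sum_const, Finset.card_univ, nsmul_eq_mul]
      field_simp
      ring
    · rw [hform]
      positivity

theorem two_mul_sum_sq_mul_sum_sq_le {V : Type*} [Fintype V] {f g : V → ℝ}
    (hf : ∑ v, f v = 0) (hg : ∑ v, g v = 0) :
    2 * ((∑ v, f v ^ 2) * ∑ v, g v ^ 2) ≤ ∑ v, ∑ w, (f v - f w) ^ 2 * (g v - g w) ^ 2 := by
  have hinner : ∀ v, ∑ w, (f v - f w) ^ 2 * (g v - g w) ^ 2 =
      Fintype.card V * (f v ^ 2 * g v ^ 2) + f v ^ 2 * (∑ w, g w ^ 2)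
        + g v ^ 2 * (∑ w, f w ^ 2) + 4 * (f v * g v) * (∑ w, f w * g w)
        - 2 * f v * (∑ w, f w * g w ^ 2) - 2 * g v * (∑ w, f w ^ 2 * g w)
        + ∑ w, f w ^ 2 * g w ^ 2 := by
    intro v
    have : ∀ w, (f v - f w) ^ 2 * (g v - g w) ^ 2 =
        f v ^ 2 * g v ^ 2 + f v ^ 2 * g w ^ 2
        + g v ^ 2 * f w ^ 2 + 4 * (f v * g v) * (f w * g w)
        - 2 * f v * (f w * g w ^ 2) - 2 * g v * (f w ^ 2 * g w)
        + f w ^ 2 * g w ^ 2 - 2 * f v ^ 2 * g v * g w - 2 * f v * g v ^ 2 * f w := by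
      intro w; ring
    simp only [this, Finset.sum_add_distrib, Finset.sum_sub_distrib, ← Finset.mul_sum, hf, hg,
      Finset.sum_const, Finset.card_univ, nsmul_eq_mul]
    ring
  have hnonneg : 0 ≤ ∑ v, f v ^ 2 * g v ^ 2 := Finset.sum_nonneg fun _ _ => by positivity
  simp only [hinner, Finset.sum_add_distrib, Finset.sum_sub_distrib, ← Finset.mul_sum,
    ← Finset.sum_mul, hf, hg, Finset.sum_const, Finset.card_univ, nsmul_eq_mul]
  have hprod := mul_nonneg (Nat.cast_nonneg (α := ℝ) (Fintype.card V)) hnonneg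
  nlinarith [sq_nonneg (∑ v, f v * g v)]

theorem sq_sub_le_two_mul_sum_sq {V : Type*} [Fintype V] (f : V → ℝ) (v w : V) :
    (f v - f w) ^ 2 ≤ 2 * ∑ u, f u ^ 2 := by
  classical
  by_cases h : v = w
  · subst h
    simpa using Finset.sum_nonneg fun u _ => sq_nonneg (f u)
  · have := Finset.sum_le_sum_of_subset_of_nonneg (Finset.subset_univ {v, w})
      fun u _ _ => sq_nonneg (f u)
    rw [Finset.sum_pair h] at this
    nlinarith [sq_nonneg (f v + f w)]

/-- An uncertainty principle for the Dirichlet forms of a graph and of its complement. -/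
theorem sum_sq_mul_sum_sq_le_dirichletForm {V : Type*} [Fintype V] (G : SimpleGraph V)
    {f g : V → ℝ} (hf : ∑ v, f v = 0) (hg : ∑ v, g v = 0) :
    (∑ v, f v ^ 2) * ∑ v, g v ^ 2 ≤
      (∑ v, g v ^ 2) * dirichletForm G f + (∑ v, f v ^ 2) * dirichletForm Gᶜ g := by
  have h : ∑ v, ∑ w, (f v - f w) ^ 2 * (g v - g w) ^ 2 ≤
      (2 * ∑ v, g v ^ 2) * dirichletForm G f + (2 * ∑ v, f v ^ 2) * dirichletForm Gᶜ g := by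
    have hfb := sq_sub_le_two_mul_sum_sq f
    have hgb := sq_sub_le_two_mul_sum_sq g
    simp only [dirichletForm]
    generalize 2 * ∑ v, f v ^ 2 = a at *
    generalize 2 * ∑ v, g v ^ 2 = b at *
    rw [Finset.mul_sum, Finset.mul_sum, ← Finset.sum_add_distrib]
    refine Finset.sum_le_sum fun v _ => ?_
    rw [Finset.mul_sum, Finset.mul_sum, ← Finset.sum_add_distrib]
    refine Finset.sum_le_sum fun w _ => ?_
    by_cases hvw : v = w
    · simp [hvw]
    · by_cases hadj : G.Adj v w
      · simp only [SimpleGraph.compl_adj, hadj, if_true, not_true, and_false, if_false, mul_zero,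
          add_zero]
        rw [mul_comm]
        exact mul_le_mul_of_nonneg_right (hgb v w) (sq_nonneg _)
      · simp only [SimpleGraph.compl_adj, hadj, hvw, if_false, ne_eq, not_false_eq_true, and_self,
          if_true, mul_zero, zero_add]
        exact mul_le_mul_of_nonneg_right (hfb v w) (sq_nonneg _)
  linarith [two_mul_sum_sq_mul_sum_sq_le hf hg]

/-- **Theorem 1.3.** For every graph `G` on `n ≥ 2` vertices,
`max(Gap(G), Gap(Ḡ)) ≥ ((3 - √5)/8) · (1/(n-1))`. -/
theorem max_gap_self_compl {V : Type*} [Fintype V] (G : SimpleGraph V)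
    (hn : 2 ≤ Fintype.card V) :
    (3 - Real.sqrt 5) / 8 * (1 / ((Fintype.card V : ℝ) - 1)) ≤
      max (spectralGap G) (spectralGap Gᶜ) := by
  by_contra! hlt
  obtain ⟨hG, hGc⟩ := max_lt_iff.1 hlt
  have hc : 0 ≤ (3 - Real.sqrt 5) / 8 ∧ (3 - Real.sqrt 5) / 8 < 1 / 4 := by
    have h3 : Real.sqrt 5 ≤ 3 := Real.sqrt_le_iff.2 (by norm_num)
    have h1 : 1 < Real.sqrt 5 := Real.lt_sqrt_of_sq_lt (by norm_num)
    constructor <;> linarith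
  obtain ⟨f, hf, hf0, hfG⟩ := exists_dirichletForm_le G hn hc.1 hG
  obtain ⟨g, hg, hg0, hgG⟩ := exists_dirichletForm_le Gᶜ hn hc.1 hGc
  have key := sum_sq_mul_sum_sq_le_dirichletForm G hf0 hg0
  have h1 := mul_le_mul_of_nonneg_left hfG hg.le
  have h2 := mul_le_mul_of_nonneg_left hgG hf.le
  have h3 := mul_lt_mul_of_pos_right hc.2 (mul_pos hf hg)
  linarith
end

section
/- Let K be a positive integer and let G be a connected finite simple graph on n ≥ 2 vertices with maximum degree Δ(G) ≥ n − K. Then Gap(G) ≥ (1/(2K))^{2K} / ((n − 1)(K + 1)). -/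
theorem Multiset.sort_getD_length_sub_two_le (s : Multiset ℝ) (t : ℝ) (hs : 2 ≤ s.card)
    (ht : s.countP (t < ·) ≤ 1) :
    (s.sort (· ≤ ·)).getD ((s.sort (· ≤ ·)).length - 2) 0 ≤ t := by
  have hsort : (s.sort (· ≤ ·)).Pairwise (· ≤ ·) := s.pairwise_sort _
  rw [← s.sort_eq (· ≤ ·), Multiset.coe_countP] at ht
  rw [← s.sort_eq (· ≤ ·), Multiset.coe_card] at hs
  generalize s.sort (· ≤ ·) = l at *
  by_contra! hlt
  rw [List.getD_eq_getElem l 0 (by omega)] at hlt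
  have hdrop : (l.drop (l.length - 2)).countP (t < ·) = (l.drop (l.length - 2)).length := by
    rw [List.countP_eq_length]
    intro a ha
    obtain ⟨k, hk, rfl⟩ := List.getElem_of_mem ha
    rw [List.getElem_drop]
    have := hsort.rel_get_of_le (a := ⟨l.length - 2, by omega⟩)
      (b := ⟨l.length - 2 + k, by simp at hk; omega⟩) (by simp)
    simpa using hlt.trans_le this
  have := (List.drop_sublist (l.length - 2) l).countP_le (p := (t < ·))
  simp only [List.length_drop] at hdrop
  omega

theorem Matrix.IsHermitian.countP_eigenvalues_le_one {V : Type*} [Fintype V] [DecidableEq V]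
    {A : Matrix V V ℝ} (hA : A.IsHermitian) (h : V) (t : ℝ)
    (hq : ∀ x : V → ℝ, x h = 0 → x ⬝ᵥ A.mulVec x ≤ t * (x ⬝ᵥ x)) :
    A.charpoly.roots.countP (t < ·) ≤ 1 := by
  have hroots : A.charpoly.roots = Multiset.map hA.eigenvalues Finset.univ.val := by
    simpa using hA.roots_charpoly_eq_eigenvalues
  rw [hroots, Multiset.countP_map]
  change (Finset.univ.filter fun i => t < hA.eigenvalues i).card ≤ 1
  rw [Finset.card_le_one]
  intro i hi j hj
  simp only [Finset.mem_filter, Finset.mem_univ, true_and] at hi hj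
  by_contra hij
  have hon (k l : V) : (hA.eigenvectorBasis k).ofLp ⬝ᵥ (hA.eigenvectorBasis l).ofLp =
      if k = l then 1 else 0 := by
    have := orthonormal_iff_ite.mp hA.eigenvectorBasis.orthonormal l k
    rw [EuclideanSpace.inner_eq_star_dotProduct] at this
    simpa [eq_comm] using this
  have hev (k : V) := hA.mulVec_eigenvectorBasis k
  set u : V → ℝ := (hA.eigenvectorBasis i).ofLp
  set w : V → ℝ := (hA.eigenvectorBasis j).ofLp
  have huu : u ⬝ᵥ u = 1 := by simpa using hon i i
  have hww : w ⬝ᵥ w = 1 := by simpa using hon j j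
  have huw : u ⬝ᵥ w = 0 := by simpa [hij] using hon i j
  have hwu : w ⬝ᵥ u = 0 := by rw [dotProduct_comm, huw]
  have hu : A.mulVec u = hA.eigenvalues i • u := hev i
  have hw : A.mulVec w = hA.eigenvalues j • w := hev j
  have key := hq (w h • u - u h • w) (by simp; ring)
  simp only [mulVec_sub, mulVec_smul, hu, hw, dotProduct_sub, sub_dotProduct, smul_dotProduct,
    dotProduct_smul, huu, hww, huw, hwu, smul_eq_mul] at key
  have hi' : 0 < hA.eigenvalues i - t := sub_pos.mpr hi
  have hj' : 0 < hA.eigenvalues j - t := sub_pos.mpr hj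
  have hu0 : u h = 0 := by
    by_contra hne
    have h1 : 0 < (u h) ^ 2 := by positivity
    nlinarith [mul_pos h1 hj', mul_nonneg (sq_nonneg (w h)) hi'.le]
  have := hq u hu0
  rw [hu, dotProduct_smul, huu, smul_eq_mul] at this
  linarith

namespace SimpleGraph

variable {V : Type*} [Fintype V] (G : SimpleGraph V)

open Classical in
/-- Twice the Dirichlet form of the random walk on `G`: the sum of `(f v - f w) ^ 2` over ordered
pairs of adjacent vertices. -/
noncomputable def dirichletSum (f : V → ℝ) : ℝ :=
  ∑ v, ∑ w, if G.Adj v w then (f v - f w) ^ 2 else 0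

theorem dirichletSum_nonneg (f : V → ℝ) : 0 ≤ G.dirichletSum f :=
  Finset.sum_nonneg fun _ _ => Finset.sum_nonneg fun _ _ => by split_ifs <;> positivity

open Classical in
theorem sum_row_le_dirichletSum (f : V → ℝ) (v : V) :
    ∑ w, (if G.Adj v w then (f v - f w) ^ 2 else 0) ≤ G.dirichletSum f :=
  Finset.single_le_sum (f := fun v => ∑ w, if G.Adj v w then (f v - f w) ^ 2 else 0)
    (fun _ _ => Finset.sum_nonneg fun _ _ => by split_ifs <;> positivity) (Finset.mem_univ v)

variable {G}

theorem Adj.sq_sub_le_dirichletSum {v w : V} (h : G.Adj v w) (f : V → ℝ) :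
    (f v - f w) ^ 2 ≤ G.dirichletSum f := by
  classical
  refine le_trans ?_ (G.sum_row_le_dirichletSum f v)
  have := Finset.single_le_sum (f := fun w => if G.Adj v w then (f v - f w) ^ 2 else 0)
    (fun _ _ => by split_ifs <;> positivity) (Finset.mem_univ w)
  simpa [h] using this

theorem Walk.abs_sub_le_length_mul_sqrt_dirichletSum {v w : V} (p : G.Walk v w) (f : V → ℝ) :
    |f v - f w| ≤ p.length * √(G.dirichletSum f) := by
  induction p with
  | nil => simp
  | @cons a b c hab p ih =>
    have h1 : |f a - f b| ≤ √(G.dirichletSum f) :=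
      Real.abs_le_sqrt (hab.sq_sub_le_dirichletSum f)
    have h2 := abs_sub_le (f a) (f b) (f c)
    rw [Walk.length_cons]
    push_cast
    linarith

open Classical in
theorem Connected.dist_add_degree_le_card (hconn : G.Connected) (h v : V) :
    G.dist h v + G.degree h ≤ Fintype.card V := by
  obtain ⟨p, hp⟩ := hconn.exists_walk_length_eq_dist h v
  have hdist (i : ℕ) (hi : i ≤ p.length) : G.dist h (p.getVert i) = i := by
    have h1 := G.dist_le (p.take i)
    have h2 := G.dist_le (p.drop i)
    have h3 := hconn.dist_triangle (u := h) (v := p.getVert i) (w := v)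
    simp only [Walk.take_length, Walk.drop_length] at h1 h2
    omega
  set s := ((Finset.range (p.length + 1)).erase 1).image p.getVert
  have hs : p.length ≤ s.card := by
    rw [Finset.card_image_of_injOn]
    · simpa using Finset.pred_card_le_card_erase (s := Finset.range (p.length + 1)) (a := 1)
    · intro i hi j hj hij
      simp only [Finset.coe_erase, Finset.coe_range, Set.mem_sdiff, Set.mem_Iio] at hi hj
      rw [← hdist i (by omega), ← hdist j (by omega)]
      exact congrArg _ hij
  have hdisj : Disjoint s (G.neighborFinset h) := by
    rw [Finset.disjoint_left]
    intro x hx hadj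
    simp only [s, Finset.mem_image, Finset.mem_erase, Finset.mem_range] at hx
    obtain ⟨i, ⟨hi1, hi⟩, rfl⟩ := hx
    rw [mem_neighborFinset, ← dist_eq_one_iff_adj, hdist i (by omega)] at hadj
    exact hi1 hadj
  have := Finset.card_le_univ (s ∪ G.neighborFinset h)
  rw [Finset.card_union_of_disjoint hdisj, card_neighborFinset_eq_degree] at this
  omega

open Classical in
theorem Connected.sum_degree_mul_sq_le (hconn : G.Connected) {h : V} {K : ℕ}
    (hK : Fintype.card V ≤ G.degree h + K) {f : V → ℝ} (hf : f h = 0) :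
    ∑ v, (G.degree v : ℝ) * f v ^ 2 ≤
      ((Fintype.card V : ℝ) - 1) * (1 + K ^ 3) * G.dirichletSum f := by
  set D := G.dirichletSum f
  have hD : 0 ≤ D := G.dirichletSum_nonneg f
  have hdeg (v : V) : (G.degree v : ℝ) ≤ (Fintype.card V : ℝ) - 1 := by
    have : G.degree v + 1 ≤ Fintype.card V := G.degree_lt_card_verts v
    have : (G.degree v : ℝ) + 1 ≤ Fintype.card V := by exact_mod_cast this
    linarith
  have hpt (v : V) : f v ^ 2 ≤ K ^ 2 * D := by
    obtain ⟨p, hp⟩ := hconn.exists_walk_length_eq_dist h v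
    have hlen : p.length ≤ K := by have := hconn.dist_add_degree_le_card h v; omega
    have h1 := p.abs_sub_le_length_mul_sqrt_dirichletSum f
    rw [hf, zero_sub, abs_neg] at h1
    have h2 : |f v| ≤ K * √D := h1.trans (by gcongr)
    calc f v ^ 2 = |f v| ^ 2 := (sq_abs _).symm
      _ ≤ (K * √D) ^ 2 := by gcongr
      _ = K ^ 2 * D := by rw [mul_pow, Real.sq_sqrt hD]
  have hnbr : ∑ v ∈ G.neighborFinset h, f v ^ 2 ≤ D := by
    refine le_trans (le_of_eq ?_) (G.sum_row_le_dirichletSum f h)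
    rw [← Finset.sum_filter]
    refine Finset.sum_congr (by ext; simp) fun v _ => by rw [hf]; ring
  have hcompl : ∑ v ∈ (G.neighborFinset h)ᶜ, f v ^ 2 ≤ K * (K ^ 2 * D) := by
    refine (Finset.sum_le_card_nsmul _ _ _ fun v _ => hpt v).trans ?_
    rw [nsmul_eq_mul]
    gcongr
    rw [Finset.card_compl, card_neighborFinset_eq_degree]
    omega
  have hsum := Finset.sum_add_sum_compl (G.neighborFinset h) fun v => f v ^ 2
  calc ∑ v, (G.degree v : ℝ) * f v ^ 2
      ≤ ∑ v, ((Fintype.card V : ℝ) - 1) * f v ^ 2 := by gcongr with v; exact hdeg v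
    _ = ((Fintype.card V : ℝ) - 1) * ∑ v, f v ^ 2 := by rw [Finset.mul_sum]
    _ ≤ ((Fintype.card V : ℝ) - 1) * ((1 + K ^ 3) * D) := by
        gcongr
        · exact (Nat.cast_nonneg _).trans (hdeg h)
        · linarith
    _ = _ := by ring

open Classical in
theorem dirichletSum_eq (f : V → ℝ) :
    G.dirichletSum f = 2 * ∑ v, (G.degree v : ℝ) * f v ^ 2 -
      2 * ∑ v, ∑ w, if G.Adj v w then f v * f w else 0 := by
  have hrow (v : V) : ∑ w, (if G.Adj v w then f v ^ 2 else 0) = (G.degree v : ℝ) * f v ^ 2 := by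
    rw [← Finset.sum_filter, Finset.sum_const, nsmul_eq_mul, ← card_neighborFinset_eq_degree,
      neighborFinset_eq_filter]
  have hcol : ∑ v, ∑ w, (if G.Adj v w then f w ^ 2 else 0) =
      ∑ v, (G.degree v : ℝ) * f v ^ 2 := by
    rw [Finset.sum_comm]
    simp_rw [G.adj_comm, hrow]
  calc G.dirichletSum f = ∑ v, ∑ w, ((if G.Adj v w then f v ^ 2 else 0) +
        (if G.Adj v w then f w ^ 2 else 0) - 2 * (if G.Adj v w then f v * f w else 0)) := by
        refine Finset.sum_congr rfl fun v _ => Finset.sum_congr rfl fun w _ => ?_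
        split_ifs <;> ring
    _ = _ := by
        simp only [Finset.sum_sub_distrib, Finset.sum_add_distrib, ← Finset.mul_sum, hrow, hcol]
        ring

variable (G)

open Classical in
/-- The adjacency matrix of `G` normalized to `1 / √(deg v * deg w)`, a symmetric matrix similar to
the transition matrix. -/
noncomputable def normalizedAdjMatrix : Matrix V V ℝ :=
  fun v w => if G.Adj v w then (√(G.degree v))⁻¹ * (√(G.degree w))⁻¹ else 0

theorem isHermitian_normalizedAdjMatrix : G.normalizedAdjMatrix.IsHermitian := by
  ext v w
  by_cases hvw : G.Adj v w
  · simp [normalizedAdjMatrix, hvw, hvw.symm, mul_comm]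
  · simp [normalizedAdjMatrix, hvw, mt G.adj_symm hvw]

theorem charpoly_transitionMatrix [DecidableEq V] :
    (transitionMatrix G).charpoly = G.normalizedAdjMatrix.charpoly := by
  classical
  set X : Matrix V V ℝ := Matrix.diagonal fun v => (√(G.degree v : ℝ))⁻¹
  set Y : Matrix V V ℝ := X * G.adjMatrix ℝ
  have hP : transitionMatrix G = X * Y := by
    ext v w
    simp only [transitionMatrix, X, Y, Matrix.diagonal_mul, adjMatrix_apply]
    split_ifs
    · rw [mul_one, ← mul_inv, Real.mul_self_sqrt (Nat.cast_nonneg _)]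
    · simp
  have hS : G.normalizedAdjMatrix = Y * X := by
    ext v w
    simp only [normalizedAdjMatrix, X, Y, Matrix.diagonal_mul, Matrix.mul_diagonal,
      adjMatrix_apply]
    split_ifs <;> simp
  rw [hP, hS, Matrix.charpoly_mul_comm]

variable {G}

open Classical in
theorem Connected.normalizedAdjMatrix_form_le (hconn : G.Connected) (hpos : ∀ v, 0 < G.degree v)
    (hn : 2 ≤ Fintype.card V) {h : V} {K : ℕ} (hK : Fintype.card V ≤ G.degree h + K)
    {x : V → ℝ} (hx : x h = 0) :
    x ⬝ᵥ G.normalizedAdjMatrix.mulVec x ≤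
      (1 - 1 / (2 * (((Fintype.card V : ℝ) - 1) * (1 + K ^ 3)))) * (x ⬝ᵥ x) := by
  have hn' : (0 : ℝ) < (Fintype.card V : ℝ) - 1 := by
    have : (2 : ℝ) ≤ Fintype.card V := by exact_mod_cast hn
    linarith
  set C : ℝ := ((Fintype.card V : ℝ) - 1) * (1 + K ^ 3)
  have hC : 0 < C := by positivity
  set f : V → ℝ := fun v => (√(G.degree v))⁻¹ * x v
  have hxx : x ⬝ᵥ x = ∑ v, (G.degree v : ℝ) * f v ^ 2 := by
    refine Finset.sum_congr rfl fun v _ => ?_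
    have : (0 : ℝ) < G.degree v := by exact_mod_cast hpos v
    simp only [f]
    rw [mul_pow, inv_pow, Real.sq_sqrt this.le]
    field_simp
  have hxS : x ⬝ᵥ G.normalizedAdjMatrix.mulVec x =
      ∑ v, ∑ w, if G.Adj v w then f v * f w else 0 := by
    simp only [dotProduct, Matrix.mulVec, Finset.mul_sum, normalizedAdjMatrix, f]
    refine Finset.sum_congr rfl fun v _ => Finset.sum_congr rfl fun w _ => ?_
    split_ifs <;> ring
  have h1 := hconn.sum_degree_mul_sq_le hK (f := f) (by simp [f, hx])
  rw [dirichletSum_eq, ← hxx, ← hxS] at h1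
  have h2 : x ⬝ᵥ x / (2 * C) ≤ x ⬝ᵥ x - x ⬝ᵥ G.normalizedAdjMatrix.mulVec x := by
    rw [div_le_iff₀ (by positivity)]
    linarith
  rw [sub_mul, one_mul, one_div_mul_eq_div]
  linarith

end SimpleGraph

open Classical in
/-- **Theorem 3.3.** If `G` is connected on `n ≥ 2` vertices with maximum degree
`Δ(G) ≥ n - K` (for a positive integer `K`), then
`Gap(G) ≥ (1/(2K))^(2K) / ((n-1)(K+1))`. -/
theorem gap_of_large_max_degree {V : Type*} [Fintype V] (G : SimpleGraph V)
    (hconn : G.Connected) (hn : 2 ≤ Fintype.card V) (K : ℕ) (hK : 0 < K)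
    (hdeg : (Fintype.card V : ℝ) - K ≤ (G.maxDegree : ℝ)) :
    ((1 : ℝ) / (2 * K)) ^ (2 * K) / (((Fintype.card V : ℝ) - 1) * (K + 1)) ≤
      spectralGap G := by
  have : Nontrivial V := Fintype.one_lt_card_iff_nontrivial.mp hn
  have hpos (v : V) : 0 < G.degree v := hconn.preconnected.degree_pos_of_nontrivial v
  obtain ⟨h, hh⟩ := G.exists_maximal_degree_vertex
  have hcard : Fintype.card V ≤ G.degree h + K := by
    rw [← hh]
    rw [sub_le_iff_le_add] at hdeg
    exact_mod_cast hdeg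
  have hn' : (0 : ℝ) < (Fintype.card V : ℝ) - 1 := by
    have : (2 : ℝ) ≤ Fintype.card V := by exact_mod_cast hn
    linarith
  have hK' : (1 : ℝ) ≤ K := by exact_mod_cast hK
  have hlam : lambda2 (transitionMatrix G) ≤
      1 - 1 / (2 * (((Fintype.card V : ℝ) - 1) * (1 + K ^ 3))) := by
    have hS := G.isHermitian_normalizedAdjMatrix
    rw [lambda2, G.charpoly_transitionMatrix]
    refine Multiset.sort_getD_length_sub_two_le _ _ ?_
      (hS.countP_eigenvalues_le_one h _ fun x hx =>
        hconn.normalizedAdjMatrix_form_le hpos hn hcard hx)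
    rw [hS.roots_charpoly_eq_eigenvalues]
    simpa using hn
  rw [spectralGap, if_pos hpos]
  have hpow : (2 * (K : ℝ)) ^ 2 ≤ (2 * K) ^ (2 * K) :=
    pow_le_pow_right₀ (by linarith) (by omega)
  have hbound : 2 * (1 + (K : ℝ) ^ 3) ≤ (2 * K) ^ (2 * K) * (K + 1) :=
    calc 2 * (1 + (K : ℝ) ^ 3) ≤ (2 * K) ^ 2 * (K + 1) := by
          nlinarith [one_le_pow₀ hK' (n := 2), one_le_pow₀ hK' (n := 3)]
      _ ≤ _ := by gcongr
  refine le_trans ?_ (le_sub_comm.mp hlam)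
  rw [one_div, inv_pow, inv_eq_one_div, div_div]
  refine one_div_le_one_div_of_le (by positivity) ?_
  calc 2 * (((Fintype.card V : ℝ) - 1) * (1 + K ^ 3))
      = ((Fintype.card V : ℝ) - 1) * (2 * (1 + K ^ 3)) := by ring
    _ ≤ ((Fintype.card V : ℝ) - 1) * ((2 * K) ^ (2 * K) * (K + 1)) := by gcongr
    _ = _ := by ring
end

section
/- Let G be a connected finite simple graph on vertex set V with n ≥ 2 vertices, and let 𝔓 = (I + P_G)/2 be the transition matrix of the lazy random walk on G. Let Q be a row-stochastic matrix indexed by V × V such that (i) Σ_{y₂} Q((x₁,x₂),(y₁,y₂)) = 𝔓(x₁,y₁) and Σ_{y₁} Q((x₁,x₂),(y₁,y₂)) = 𝔓(x₂,y₂) for all x₁, x₂, y₁, y₂ ∈ V (Q is a Markovian coupling of two copies of the lazy walk), and (ii) Q((x,x),(y₁,y₂)) = 0 whenever y₁ ≠ y₂ (once the two coordinates are equal they stay equal). Suppose there exist a positive integer J and a real A₀ with 0 < A₀ < 1 such that for every (x₁,x₂) ∈ V × V with x₁ ≠ x₂, the J-step probability Q^J((x₁,x₂), Δ) ≥ A₀,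 where Δ = {(y,y) : y ∈ V}. Then the second-largest eigenvalue of 𝔓 satisfies 1 − λ₂(𝔓) ≥ A₀/J; consequently Gap(G) ≥ 2A₀/J. -/
/-- The lazy random walk transition matrix `𝔓 = (I + P_G)/2`. -/
noncomputable def lazyMatrix {V : Type*} [Fintype V] [DecidableEq V]
    (G : SimpleGraph V) : Matrix V V ℝ :=
  (2 : ℝ)⁻¹ • (1 + transitionMatrix G)

lemma List.two_le_countP_getD_length_sub_two_le {L : List ℝ} (hL : L.Pairwise (· ≤ ·))
    (hlen : 2 ≤ L.length) : 2 ≤ L.countP (fun x => L.getD (L.length - 2) 0 ≤ x) := by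
  have hlt : L.length - 2 < L.length := by omega
  have hall : (L.drop (L.length - 2)).countP (fun x => L.getD (L.length - 2) 0 ≤ x) =
      (L.drop (L.length - 2)).length := by
    rw [List.countP_eq_length]
    intro a ha
    obtain ⟨k, hk, rfl⟩ := List.mem_iff_getElem.1 ha
    simp only [List.getElem_drop, List.getD_eq_getElem _ _ hlt, decide_eq_true_eq]
    exact hL.sortedLE.getElem_le_getElem_of_le (by omega)
  calc 2 ≤ (L.drop (L.length - 2)).length := by rw [List.length_drop]; omega
    _ = _ := hall.symm
    _ ≤ _ := (List.drop_sublist _ L).countP_le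

lemma Matrix.IsHermitian.exists_ne_lambda2_le_eigenvalues {V : Type*} [Fintype V] [DecidableEq V]
    {N : Matrix V V ℝ} (hN : N.IsHermitian) (hn : 2 ≤ Fintype.card V) :
    ∃ i j, i ≠ j ∧ lambda2 N ≤ hN.eigenvalues i ∧ lambda2 N ≤ hN.eigenvalues j := by
  have hroots : N.charpoly.roots = Finset.univ.val.map hN.eigenvalues := by
    simpa [Function.comp_def] using hN.roots_charpoly_eq_eigenvalues
  have hcount : 2 ≤ N.charpoly.roots.countP (fun x => lambda2 N ≤ x) := by
    conv_rhs => rw [← Multiset.sort_eq N.charpoly.roots (· ≤ ·)]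
    rw [Multiset.coe_countP]
    refine List.two_le_countP_getD_length_sub_two_le (Multiset.pairwise_sort _ _) ?_
    rw [Multiset.length_sort, hroots, Multiset.card_map]
    exact hn
  rw [hroots, Multiset.countP_map] at hcount
  obtain ⟨i, hi, j, hj, hij⟩ := Finset.one_lt_card.1
    (show 1 < (Finset.univ.filter fun i => lambda2 N ≤ hN.eigenvalues i).card from hcount)
  exact ⟨i, j, hij, (Finset.mem_filter.1 hi).2, (Finset.mem_filter.1 hj).2⟩

/-- A matrix satisfying detailed balance with respect to a positive weight has a nonconstant
eigenvector whose eigenvalue is at least the second-largest one. -/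
lemma exists_nonconstant_eigenvector_of_detailed_balance {V : Type*} [Fintype V] [DecidableEq V]
    {M : Matrix V V ℝ} {d : V → ℝ} (hd : ∀ v, 0 < d v)
    (hM : ∀ v w, d v * M v w = d w * M w v) (hn : 2 ≤ Fintype.card V) :
    ∃ (μ : ℝ) (f : V → ℝ), lambda2 M ≤ μ ∧ M.mulVec f = μ • f ∧ ∃ x y, f x ≠ f y := by
  set s : V → ℝ := fun v => √(d v) with hs
  have hs0 : ∀ v, s v ≠ 0 := fun v => (Real.sqrt_pos.2 (hd v)).ne'
  have hsq : ∀ v, s v * s v = d v := fun v => Real.mul_self_sqrt (hd v).le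
  have hinv : Matrix.diagonal s⁻¹ * Matrix.diagonal s = 1 := by
    rw [Matrix.diagonal_mul_diagonal, ← Matrix.diagonal_one]
    congr 1
    ext v
    simp [hs0 v]
  set N : Matrix V V ℝ := Matrix.diagonal s * (M * Matrix.diagonal s⁻¹) with hNdef
  have hNapply : ∀ v w, N v w = s v * M v w * (s w)⁻¹ := fun v w => by
    simp [hNdef, mul_assoc]
  have hN : N.IsHermitian := by
    ext v w
    simp only [Matrix.conjTranspose_apply, star_trivial, hNapply]
    have h := hM v w
    rw [← hsq, ← hsq] at h
    have hv := hs0 v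
    have hw := hs0 w
    field_simp
    linear_combination -h
  have hchar : N.charpoly = M.charpoly := by
    rw [hNdef, Matrix.charpoly_mul_comm, Matrix.mul_assoc, hinv, Matrix.mul_one]
  have hlam : lambda2 N = lambda2 M := by simp only [lambda2, hchar]
  obtain ⟨i, j, hij, hi, hj⟩ := hN.exists_ne_lambda2_le_eigenvalues hn
  rw [hlam] at hi hj
  let u : V → V → ℝ := fun k v => (s v)⁻¹ * hN.eigenvectorBasis k v
  have hu : ∀ k, M.mulVec (u k) = hN.eigenvalues k • u k := fun k => by
    ext v
    have h := congrFun (hN.mulVec_eigenvectorBasis k) v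
    simp only [Matrix.mulVec, dotProduct, hNapply, Pi.smul_apply, smul_eq_mul] at h ⊢
    rw [← mul_right_inj' (hs0 v)]
    calc s v * ∑ w, M v w * u k w
        = ∑ w, s v * M v w * (s w)⁻¹ * hN.eigenvectorBasis k w := by
          rw [Finset.mul_sum]
          exact Finset.sum_congr rfl fun w _ => by simp only [u]; ring
      _ = _ := by
          rw [h]
          simp only [u]
          field_simp [hs0 v]
  have hb : ∀ k v, hN.eigenvectorBasis k v = s v * u k v := fun k v => by
    simp only [u]
    field_simp [hs0 v]
  have hnon : (∃ x y, u i x ≠ u i y) ∨ ∃ x y, u j x ≠ u j y := by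
    by_contra! hcon
    obtain ⟨hci, hcj⟩ := hcon
    have hli := hN.eigenvectorBasis.orthonormal.linearIndependent
    obtain ⟨x⟩ : Nonempty V := ⟨i⟩
    have hcomb : u j x • hN.eigenvectorBasis i + (-u i x) • hN.eigenvectorBasis j = 0 := by
      ext v
      simp only [PiLp.add_apply, PiLp.smul_apply, smul_eq_mul, hb, hci v x, hcj v x,
        PiLp.zero_apply]
      ring
    have hpair : LinearIndependent ℝ ![hN.eigenvectorBasis i, hN.eigenvectorBasis j] := by
      have hcomp : ![hN.eigenvectorBasis i, hN.eigenvectorBasis j] =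
          hN.eigenvectorBasis ∘ ![i, j] := by
        funext k
        fin_cases k <;> rfl
      rw [hcomp]
      exact hli.comp _ (by simpa [Function.Injective, Fin.forall_fin_two] using ⟨hij, hij.symm⟩)
    obtain ⟨-, h0⟩ := LinearIndependent.pair_iff.1 hpair _ _ hcomb
    refine hli.ne_zero i ?_
    ext v
    simp only [hb, hci v x, neg_eq_zero.1 h0, PiLp.zero_apply, mul_zero]
  rcases hnon with h | h
  · exact ⟨_, u i, hi, hu i, h⟩
  · exact ⟨_, u j, hj, hu j, h⟩

/-- If a Markovian coupling of two copies of `M` meets within `J` steps with probability at least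
`A`, every eigenvalue of `M` with a nonconstant eigenvector satisfies `μ ^ J ≤ 1 - A`. -/
lemma pow_le_one_sub_of_coupling {V : Type*} [Fintype V] [DecidableEq V]
    {M : Matrix V V ℝ} {Q : Matrix (V × V) (V × V) ℝ}
    (hQ : Q ∈ Matrix.rowStochastic ℝ (V × V))
    (hmarg1 : ∀ x₁ x₂ y₁ : V, ∑ y₂ : V, Q (x₁, x₂) (y₁, y₂) = M x₁ y₁)
    (hmarg2 : ∀ x₁ x₂ y₂ : V, ∑ y₁ : V, Q (x₁, x₂) (y₁, y₂) = M x₂ y₂)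
    {J : ℕ} {A : ℝ}
    (hstep : ∀ x₁ x₂ : V, x₁ ≠ x₂ → A ≤ ∑ y : V, (Q ^ J) (x₁, x₂) (y, y))
    {μ : ℝ} {f : V → ℝ} (hf : M.mulVec f = μ • f) (hne : ∃ x y, f x ≠ f y) :
    μ ^ J ≤ 1 - A := by
  obtain ⟨a, b, hab⟩ := hne
  have : Nonempty V := ⟨a⟩
  obtain ⟨x, hx⟩ := Finite.exists_max f
  obtain ⟨y, hy⟩ := Finite.exists_min f
  have hm : 0 < f x - f y := by
    rcases lt_or_gt_of_ne hab with h | h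
    · linarith [hx b, hy a]
    · linarith [hx a, hy b]
  set g : V × V → ℝ := fun q => f q.1 - f q.2 with hg
  have hQg : Q.mulVec g = μ • g := by
    ext ⟨p₁, p₂⟩
    have h1 := congrFun hf p₁
    have h2 := congrFun hf p₂
    simp only [Matrix.mulVec, dotProduct, Pi.smul_apply, smul_eq_mul, hg] at h1 h2 ⊢
    simp only [mul_sub, Finset.sum_sub_distrib]
    congr 1
    · rw [← h1, Fintype.sum_prod_type]
      simp only [← Finset.sum_mul, hmarg1]
    · rw [← h2, Fintype.sum_prod_type_right]
      simp only [← Finset.sum_mul, hmarg2]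
  have hQJg : ∀ k : ℕ, (Q ^ k).mulVec g = μ ^ k • g := fun k => by
    induction k with
    | zero => simp
    | succ k ih =>
      rw [pow_succ, ← Matrix.mulVec_mulVec, hQg, Matrix.mulVec_smul, ih, smul_smul, pow_succ']
  have hQJ := pow_mem hQ J
  have hle : μ ^ J * (f x - f y) ≤
      ∑ q, (Q ^ J) (x, y) q * ((f x - f y) * (1 - if q.1 = q.2 then 1 else 0)) := by
    have h := congrFun (hQJg J) (x, y)
    simp only [Matrix.mulVec, dotProduct, Pi.smul_apply, smul_eq_mul] at h
    rw [show f x - f y = g (x, y) from rfl, ← h]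
    refine Finset.sum_le_sum fun q _ =>
      mul_le_mul_of_nonneg_left ?_ (Matrix.nonneg_of_mem_rowStochastic hQJ)
    rcases q with ⟨q₁, q₂⟩
    by_cases hq : q₁ = q₂
    · simp [hg, hq]
    · simp only [hg, hq, if_false, sub_zero, mul_one]
      linarith [hx q₁, hy q₂]
  have hdiag : ∑ q : V × V, (Q ^ J) (x, y) q * (if q.1 = q.2 then 1 else 0) =
      ∑ z, (Q ^ J) (x, y) (z, z) := by
    simp [Fintype.sum_prod_type]
  have hsum : ∑ q, (Q ^ J) (x, y) q * ((f x - f y) * (1 - if q.1 = q.2 then 1 else 0)) =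
      (∑ q, (Q ^ J) (x, y) q - ∑ z, (Q ^ J) (x, y) (z, z)) * (f x - f y) := by
    rw [← hdiag, ← Finset.sum_sub_distrib, Finset.sum_mul]
    exact Finset.sum_congr rfl fun q _ => by ring
  rw [hsum, Matrix.sum_row_of_mem_rowStochastic hQJ] at hle
  have hxy : x ≠ y := by
    rintro rfl
    simp at hm
  linarith [le_of_mul_le_mul_right hle hm, hstep x y hxy]

lemma div_le_one_sub_of_pow_le {J : ℕ} (hJ : 0 < J) {A μ : ℝ} (hA : A ≤ 1)
    (h : μ ^ J ≤ 1 - A) : A / J ≤ 1 - μ := by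
  have hJ' : (0 : ℝ) < J := Nat.cast_pos.2 hJ
  have hdiv : A / J ≤ 1 := (div_le_one hJ').2
    (hA.trans (by exact_mod_cast hJ))
  have hbern := one_add_mul_le_pow (a := -(A / J)) (by linarith) J
  have hmul : (J : ℝ) * (A / J) = A := mul_div_cancel₀ A hJ'.ne'
  by_contra! hlt
  have hstrict := pow_lt_pow_left₀ (show 1 + -(A / J) < μ by linarith) (by linarith) hJ.ne'
  linarith

lemma degree_mul_transitionMatrix_comm {V : Type*} [Fintype V] (G : SimpleGraph V)
    [G.LocallyFinite] (hdeg : ∀ v, 0 < G.degree v) (v w : V) :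
    (G.degree v : ℝ) * transitionMatrix G v w = G.degree w * transitionMatrix G w v := by
  have hv : (G.degree v : ℝ) ≠ 0 := by exact_mod_cast (hdeg v).ne'
  have hw : (G.degree w : ℝ) ≠ 0 := by exact_mod_cast (hdeg w).ne'
  unfold transitionMatrix
  by_cases h : G.Adj v w
  · rw [if_pos h, if_pos h.symm]
    convert (mul_inv_cancel₀ hv).trans (mul_inv_cancel₀ hw).symm <;> rfl
  · rw [if_neg h, if_neg fun h' => h h'.symm, mul_zero, mul_zero]

open Classical in
/-- **Lemma 2.2.** If `Q` is a Markovian coupling of two copies of the lazy walk `𝔓`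
on a connected graph `G` which sticks together on the diagonal, and from every
off-diagonal state the `J`-step probability of hitting the diagonal is at least `A₀`,
then `1 - λ₂(𝔓) ≥ A₀/J`; consequently `Gap(G) ≥ 2A₀/J`. -/
theorem gap_of_coupling {V : Type*} [Fintype V] (G : SimpleGraph V)
    (hconn : G.Connected) (hn : 2 ≤ Fintype.card V)
    (Q : Matrix (V × V) (V × V) ℝ)
    (hQ0 : ∀ p q, 0 ≤ Q p q)
    (hQrow : ∀ p, ∑ q, Q p q = 1)
    (hmarg1 : ∀ x₁ x₂ y₁ : V, ∑ y₂ : V, Q (x₁, x₂) (y₁, y₂) = lazyMatrix G x₁ y₁)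
    (hmarg2 : ∀ x₁ x₂ y₂ : V, ∑ y₁ : V, Q (x₁, x₂) (y₁, y₂) = lazyMatrix G x₂ y₂)
    (hdiag : ∀ x y₁ y₂ : V, y₁ ≠ y₂ → Q (x, x) (y₁, y₂) = 0)
    (J : ℕ) (hJ : 0 < J) (A₀ : ℝ) (hA₀0 : 0 < A₀) (hA₀1 : A₀ < 1)
    (hstep : ∀ x₁ x₂ : V, x₁ ≠ x₂ → A₀ ≤ ∑ y : V, (Q ^ J) (x₁, x₂) (y, y)) :
    A₀ / J ≤ 1 - lambda2 (lazyMatrix G) ∧ 2 * A₀ / J ≤ spectralGap G := by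
  have hcard : Nontrivial V := Fintype.one_lt_card_iff_nontrivial.1 hn
  have hdeg : ∀ v, 0 < G.degree v := fun v =>
    hconn.preconnected.degree_pos_of_nontrivial v
  have hd : ∀ v, (0 : ℝ) < G.degree v := fun v => Nat.cast_pos.2 (hdeg v)
  have hrev := degree_mul_transitionMatrix_comm G hdeg
  have hlazy : ∀ v w, (G.degree v : ℝ) * lazyMatrix G v w = G.degree w * lazyMatrix G w v := by
    intro v w
    rcases eq_or_ne v w with rfl | hvw
    · rfl
    · simp only [lazyMatrix, Matrix.smul_apply, Matrix.add_apply, Matrix.one_apply_ne hvw,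
        Matrix.one_apply_ne hvw.symm, smul_eq_mul, zero_add]
      linear_combination (2 : ℝ)⁻¹ * hrev v w
  have hQ : Q ∈ Matrix.rowStochastic ℝ (V × V) :=
    Matrix.mem_rowStochastic_iff_sum.2 ⟨hQ0, hQrow⟩
  have key : ∀ (μ : ℝ) (f : V → ℝ), (lazyMatrix G).mulVec f = μ • f → (∃ x y, f x ≠ f y) →
      A₀ / J ≤ 1 - μ := fun μ f hf hne =>
    div_le_one_sub_of_pow_le hJ hA₀1.le
      (pow_le_one_sub_of_coupling hQ hmarg1 hmarg2 hstep hf hne)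
  constructor
  · obtain ⟨μ, f, hμ, hf, hne⟩ := exists_nonconstant_eigenvector_of_detailed_balance hd hlazy hn
    linarith [key μ f hf hne]
  · obtain ⟨μ, f, hμ, hf, hne⟩ := exists_nonconstant_eigenvector_of_detailed_balance hd hrev hn
    have hf' : (lazyMatrix G).mulVec f = ((1 + μ) / 2) • f := by
      rw [lazyMatrix, Matrix.smul_mulVec, Matrix.add_mulVec, Matrix.one_mulVec, hf]
      module
    rw [spectralGap, if_pos hdeg, mul_div_assoc]
    linarith [key _ f hf' hne]
end
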